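/- Let Δ be a simplicial complex on [n] each of whose facets is a proper subset of [n]. Then Δ is a quasi-tree if and only if the facet ideal I(Δ^c) ⊆ S = K[x_1,…,x_n] has projective dimension at most 1 as an S-module (equivalently, if Δ has at least two facets, projective dimension exactly 1). -/

import Mathlib

open Finset

/-- A simplicial complex on the vertex set `Fin n`: contains all singletons and is
closed under taking subsets. -/
def IsComplex {n : ℕ} (Δ : Set (Finset (Fin n))) : Prop :=
  (∀ i : Fin n, {i} ∈ Δ) ∧ ∀ F ∈ Δ, ∀ G ⊆ F, G ∈ Δ

/-- Closed under taking subsets (a simplicial complex, singletons not required). -/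
def IsLowerComplex {n : ℕ} (Δ : Set (Finset (Fin n))) : Prop :=
  ∀ F ∈ Δ, ∀ G ⊆ F, G ∈ Δ

/-- The set of facets (maximal faces) of `Δ`. -/
def facets {n : ℕ} (Δ : Set (Finset (Fin n))) : Set (Finset (Fin n)) :=
  {F | F ∈ Δ ∧ ∀ G ∈ Δ, F ⊆ G → F = G}

/-- The simplicial complex generated by a family of subsets of `Fin n`. -/
def gen {n : ℕ} (S : Set (Finset (Fin n))) : Set (Finset (Fin n)) :=
  {G | ∃ F ∈ S, G ⊆ F}

/-- `F` is a leaf of `Δ`: either `F` is the only facet, or there is a facet `G ≠ F`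
(a branch of `F`) with `H ∩ F ⊆ G ∩ F` for every facet `H ≠ F`. -/
def IsLeaf {n : ℕ} (Δ : Set (Finset (Fin n))) (F : Finset (Fin n)) : Prop :=
  F ∈ facets Δ ∧
    (facets Δ = {F} ∨ ∃ G ∈ facets Δ, G ≠ F ∧ ∀ H ∈ facets Δ, H ≠ F → H ∩ F ⊆ G ∩ F)

/-- `Δ` is a quasi-tree: there is a labeling `F₁, …, F_m` of its facets such that `F_i`
is a leaf of `⟨F₁, …, F_i⟩` for every `i` (a leaf order). -/
def IsQuasiTree {n : ℕ} (Δ : Set (Finset (Fin n))) : Prop :=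
  ∃ L : List (Finset (Fin n)), L.Nodup ∧ {F | F ∈ L} = facets Δ ∧
    ∀ i : Fin L.length, IsLeaf (gen {F | F ∈ L.take (i.1 + 1)}) (L.get i)

/-- `Δ` is pure: all facets have the same cardinality. -/
def IsPure {n : ℕ} (Δ : Set (Finset (Fin n))) : Prop :=
  ∀ F ∈ facets Δ, ∀ G ∈ facets Δ, F.card = G.card

/-- `Δ` is shellable: it is pure and there is an order `F₁, …, F_m` of its facets such
that for all `j < i` and `x ∈ F_i \ F_j` there is `k < i` with `F_i \ F_k = {x}`. -/
def IsShellable {n : ℕ} (Δ : Set (Finset (Fin n))) : Prop :=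
  IsPure Δ ∧ ∃ L : List (Finset (Fin n)), L.Nodup ∧ {F | F ∈ L} = facets Δ ∧
    ∀ i j : Fin L.length, j < i →
      ∀ x ∈ L.get i \ L.get j, ∃ k : Fin L.length, k < i ∧ L.get i \ L.get k = {x}

/-- The `i`-skeleton of `Δ`: the complex generated by the faces of dimension `i`. -/
def skel {n : ℕ} (Δ : Set (Finset (Fin n))) (i : ℕ) : Set (Finset (Fin n)) :=
  gen {F | F ∈ Δ ∧ F.card = i + 1}

/-- The Alexander dual of `Δ`: `Δ^∨ = {[n] \ F : F ∉ Δ}`. -/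
def dual {n : ℕ} (Δ : Set (Finset (Fin n))) : Set (Finset (Fin n)) :=
  {G | Gᶜ ∉ Δ}

/-- `Δ^c`, the complex generated by the complements of the facets of `Δ`. -/
def complements {n : ℕ} (Δ : Set (Finset (Fin n))) : Set (Finset (Fin n)) :=
  gen ((·ᶜ) '' facets Δ)

/-- `Δ` is flag: every minimal nonface has exactly two elements. -/
def IsFlag {n : ℕ} (Δ : Set (Finset (Fin n))) : Prop :=
  ∀ F : Finset (Fin n), F ∉ Δ → (∀ G ⊂ F, G ∈ Δ) → F.card = 2

/-- The squarefree monomial `x_F = ∏_{i ∈ F} x_i`. -/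
noncomputable def xF {n : ℕ} (K : Type) [Field K] (F : Finset (Fin n)) :
    MvPolynomial (Fin n) K := ∏ i ∈ F, MvPolynomial.X i

/-- The Stanley–Reisner ideal of `Δ`, generated by the monomials `x_F` with `F` a
nonface of `Δ`. -/
noncomputable def SRIdeal {n : ℕ} (K : Type) [Field K] (Δ : Set (Finset (Fin n))) :
    Ideal (MvPolynomial (Fin n) K) := Ideal.span (xF K '' {F | F ∉ Δ})

/-- The facet ideal of `Δ`, generated by the monomials `x_F` with `F` a facet of `Δ`. -/
noncomputable def facetIdeal {n : ℕ} (K : Type) [Field K] (Δ : Set (Finset (Fin n))) :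
    Ideal (MvPolynomial (Fin n) K) := Ideal.span (xF K '' facets Δ)

/-- A set `G` of monomials (assumed to be the minimal monomial generating set of the
ideal it generates) has linear quotients: there is an order `f₁, …, f_m` of `G` such
that each colon ideal `(f₁,…,f_{i-1}) : f_i` is generated by a set of variables. -/
def HasLinearQuotients {n : ℕ} (K : Type) [Field K]
    (G : Set (MvPolynomial (Fin n) K)) : Prop :=
  ∃ L : List (MvPolynomial (Fin n) K), L.Nodup ∧ {f | f ∈ L} = G ∧
    ∀ i : Fin L.length, 0 < i.1 →
      ∃ V : Set (Fin n),
        Submodule.colon (Ideal.span {f | f ∈ L.take i.1}) (Ideal.span {L.get i}) =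
          Ideal.span (MvPolynomial.X '' V)

/-- The clique complex `Δ(G)` of a graph `G`: faces are the cliques of `G`. -/
def cliqueComplex {n : ℕ} (G : SimpleGraph (Fin n)) : Set (Finset (Fin n)) :=
  {F | ∀ i ∈ F, ∀ j ∈ F, i ≠ j → G.Adj i j}

/-- A graph is chordal if every cycle of length at least 4 has a chord, i.e. an edge of
the graph joining two vertices of the cycle which is not an edge of the cycle. -/
def IsChordalGraph {V : Type} (G : SimpleGraph V) : Prop :=
  ∀ (v : V) (c : G.Walk v v), c.IsCycle → 4 ≤ c.length →
    ∃ x y, G.Adj x y ∧ x ∈ c.support ∧ y ∈ c.support ∧ s(x, y) ∉ c.edges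

/-- A module `M` over `S` has projective dimension at most one: some (equivalently, by
Schanuel's lemma, any) presentation of `M` by a free module has projective kernel. -/
def ProjDimLEOne (S : Type) [CommRing S] (M : Type) [AddCommGroup M] [Module S M] : Prop :=
  ∃ (ι : Type) (f : (ι →₀ S) →ₗ[S] M), Function.Surjective f ∧
    Module.Projective S (LinearMap.ker f)

/-- The monomial with exponent vector `a`. -/
noncomputable def mono {n : ℕ} (K : Type) [Field K] (a : Fin n → ℕ) :
    MvPolynomial (Fin n) K := MvPolynomial.monomial (Finsupp.equivFunOnFinite.symm a) 1

/-- The Taylor relation `r_{ij} = u_{ji} e_i - u_{ij} e_j` for the monomials with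
exponent vectors `a i`, `a j`, where `u_{ij} = u_i / gcd(u_i, u_j)`. -/
noncomputable def taylorRel {n t : ℕ} (K : Type) [Field K] (a : Fin t → Fin n → ℕ)
    (i j : Fin t) : Fin t → MvPolynomial (Fin n) K :=
  Pi.single i (mono K (a j - a i ⊓ a j)) - Pi.single j (mono K (a i - a i ⊓ a j))

open MvPolynomial

section Homological

variable {R : Type*} [CommRing R] {M N : Type*} [AddCommGroup M] [Module R M]
  [AddCommGroup N] [Module R N]

/-- Schanuel's lemma: if one projective presentation of a module has projective kernel, then
every projective presentation does. -/
theorem projective_ker_of_projective_ker {P : Type*} [AddCommGroup P] [Module R P]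
    [Module.Projective R M] [Module.Projective R P] (f : P →ₗ[R] N) (g : M →ₗ[R] N)
    (hf : Function.Surjective f) (hg : Function.Surjective g)
    [Module.Projective R (LinearMap.ker f)] : Module.Projective R (LinearMap.ker g) := by
  obtain ⟨σ, hσ⟩ := Module.projective_lifting_property g f hg
  obtain ⟨τ, hτ⟩ := Module.projective_lifting_property f g hf
  have hσ' (p : P) : g (σ p) = f p := LinearMap.congr_fun hσ p
  have hτ' (m : M) : f (τ m) = g m := LinearMap.congr_fun hτ m
  let i : LinearMap.ker g →ₗ[R] LinearMap.ker f × M :=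
    LinearMap.prod
      (LinearMap.codRestrict (LinearMap.ker f) (-(τ ∘ₗ (LinearMap.ker g).subtype)) fun q ↦ by
        simp [hτ'])
      (LinearMap.ker g).subtype
  let s : LinearMap.ker f × M →ₗ[R] LinearMap.ker g :=
    LinearMap.codRestrict (LinearMap.ker g)
      (LinearMap.snd R _ _ - σ ∘ₗ ((LinearMap.ker f).subtype.coprod τ)) fun q ↦ by
        simp [hσ', hτ']
  refine Module.Projective.of_split i s ?_
  ext q
  change (q : M) - σ (-τ q + τ q) = q
  simp

theorem ProjDimLEOne.projective_ker {S N : Type} [CommRing S] [AddCommGroup N] [Module S N]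
    (h : ProjDimLEOne S N) {M : Type*} [AddCommGroup M] [Module S M] [Module.Projective S M]
    (g : M →ₗ[S] N) (hg : Function.Surjective g) : Module.Projective S (LinearMap.ker g) := by
  obtain ⟨ι, f, hf, hker⟩ := h
  exact projective_ker_of_projective_ker f g hf hg

theorem ProjDimLEOne.of_free {S M N : Type} [CommRing S] [AddCommGroup M] [Module S M]
    [Module.Free S M] [AddCommGroup N] [Module S N] (f : M →ₗ[S] N)
    [Module.Projective S (LinearMap.ker f)] : ProjDimLEOne S (LinearMap.range f) := by
  let e := (Module.Free.chooseBasis S M).repr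
  refine ⟨_, f.rangeRestrict ∘ₗ e.symm.toLinearMap, ?_, ?_⟩
  · exact f.surjective_rangeRestrict.comp e.symm.surjective
  · have : Module.Projective S (LinearMap.ker f.rangeRestrict) := by
      rwa [LinearMap.ker_rangeRestrict]
    exact projective_ker_of_projective_ker f.rangeRestrict _ f.surjective_rangeRestrict
      (f.surjective_rangeRestrict.comp e.symm.surjective)

/-- Adjoining one generator `u` whose colon ideal over the previous ones is generated by a
regular element `v` adds a free summand to the kernel of a presentation. -/
theorem projective_ker_coprod_toSpanSingleton [Module.Projective R (LinearMap.ker (f : M →ₗ[R] N))]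
    (u : N) (v : R) (hv : v ∈ nonZeroDivisors R)
    (hcolon : ∀ c : R, c • u ∈ LinearMap.range f ↔ v ∣ c) :
    Module.Projective R (LinearMap.ker (f.coprod (LinearMap.toSpanSingleton R N u))) := by
  obtain ⟨m, hm⟩ := (hcolon v).2 dvd_rfl
  let F : LinearMap.ker f × R →ₗ[R] LinearMap.ker (f.coprod (LinearMap.toSpanSingleton R N u)) :=
    LinearMap.codRestrict _
      (LinearMap.prod
        ((LinearMap.ker f).subtype.coprod (-LinearMap.toSpanSingleton R M m))
        (LinearMap.toSpanSingleton R R v ∘ₗ LinearMap.snd R _ _)) fun q ↦ by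
      simp [hm, mul_smul]
  have hF (q) : (F q : M × R) = ((q.1 : M) - q.2 • m, q.2 * v) := by simp [F, sub_eq_add_neg]
  refine Module.Projective.of_equiv (LinearEquiv.ofBijective F ⟨?_, ?_⟩)
  · rw [injective_iff_map_eq_zero]
    rintro ⟨k, d⟩ h
    have h' := hF (k, d)
    rw [h] at h'
    simp only [ZeroMemClass.coe_zero, Prod.ext_iff, Prod.fst_zero, Prod.snd_zero] at h'
    have hd : d = 0 := (mul_right_mem_nonZeroDivisors_eq_zero_iff hv).1 h'.2.symm
    have hk := h'.1
    rw [hd] at hk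
    ext
    · simpa using hk.symm
    · simpa using hd
  · rintro ⟨⟨k, c⟩, hkc⟩
    have hkc' : f k + c • u = 0 := by simpa using hkc
    obtain ⟨d, rfl⟩ := (hcolon c).1 ⟨-k, by rw [map_neg]; exact neg_eq_of_add_eq_zero_right hkc'⟩
    refine ⟨(⟨k + d • m, ?_⟩, d), ?_⟩
    · rw [LinearMap.mem_ker, map_add, map_smul, hm, ← hkc', smul_smul, mul_comm]
    · apply Subtype.ext
      rw [hF]
      simp [mul_comm]

end Homological

section MonomialSyzygies

variable {σ ι : Type*} (K : Type*) [Field K]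

/-- The monomial map `e_i ↦ x^{a i}` from a free module to the polynomial ring. -/
noncomputable def monomialPresentation [Fintype ι] (a : ι → σ →₀ ℕ) :
    (ι → MvPolynomial σ K) →ₗ[MvPolynomial σ K] MvPolynomial σ K :=
  Fintype.linearCombination _ fun i ↦ monomial (a i) 1

/-- The Taylor relation between the `i`-th and `j`-th monomial. -/
noncomputable def monomialSyzygy [DecidableEq ι] (a : ι → σ →₀ ℕ) (p : ι × ι) :
    ι → MvPolynomial σ K :=
  Pi.single p.1 (monomial (a p.2 - a p.1) 1) - Pi.single p.2 (monomial (a p.1 - a p.2) 1)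

variable {K}

theorem monomialPresentation_apply [Fintype ι] (a : ι → σ →₀ ℕ) (c : ι → MvPolynomial σ K) :
    monomialPresentation K a c = ∑ i, c i * monomial (a i) 1 := rfl

theorem range_monomialPresentation [Fintype ι] (a : ι → σ →₀ ℕ) :
    LinearMap.range (monomialPresentation K a) =
      Ideal.span (Set.range fun i ↦ monomial (a i) (1 : K)) :=
  Fintype.range_linearCombination _ _

theorem monomialSyzygy_mem_ker [Fintype ι] [DecidableEq ι] (a : ι → σ →₀ ℕ) (p : ι × ι) :
    monomialSyzygy K a p ∈ LinearMap.ker (monomialPresentation K a) := by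
  have h : a p.2 - a p.1 + a p.1 = a p.1 - a p.2 + a p.2 := by
    ext x
    simp only [Finsupp.add_apply, Finsupp.tsub_apply]
    omega
  simp [monomialSyzygy, monomialPresentation, Fintype.linearCombination_apply_single, h]

theorem monomialSyzygy_apply_fst [DecidableEq ι] (a : ι → σ →₀ ℕ) {i j : ι} (h : i ≠ j) :
    monomialSyzygy K a (i, j) i = monomial (a j - a i) 1 := by
  simp [monomialSyzygy, h]

theorem monomialSyzygy_apply_snd [DecidableEq ι] (a : ι → σ →₀ ℕ) {i j : ι} (h : i ≠ j) :
    monomialSyzygy K a (i, j) j = -monomial (a i - a j) 1 := by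
  simp [monomialSyzygy, h.symm]

theorem monomialSyzygy_apply_of_ne [DecidableEq ι] (a : ι → σ →₀ ℕ) {i : ι} {p : ι × ι}
    (h₁ : p.1 ≠ i) (h₂ : p.2 ≠ i) : monomialSyzygy K a p i = 0 := by
  simp [monomialSyzygy, h₁.symm, h₂.symm]

theorem monomialSyzygy_self [DecidableEq ι] (a : ι → σ →₀ ℕ) (i : ι) :
    monomialSyzygy K a (i, i) = 0 := by
  simp [monomialSyzygy]

/-- The Taylor relations generate all relations between monomials. -/
theorem ker_monomialPresentation [Fintype ι] [DecidableEq ι] (a : ι → σ →₀ ℕ) :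
    LinearMap.ker (monomialPresentation K a) =
      Submodule.span (MvPolynomial σ K) (Set.range (monomialSyzygy K a)) := by
  classical
  refine le_antisymm (fun c hc ↦ ?_)
    (Submodule.span_le.2 <| Set.range_subset_iff.2 <| monomialSyzygy_mem_ker a)
  induction hN : ∑ i, (c i).support.card using Nat.strong_induction_on generalizing c with
  | _ N ih =>
    subst hN
    by_cases hc0 : c = 0
    · rw [hc0]
      exact zero_mem _
    obtain ⟨i, hi⟩ := Function.ne_iff.1 hc0
    obtain ⟨d, hd⟩ := MvPolynomial.ne_zero_iff.1 hi
    have hsum : ∑ j, coeff (d + a i) (c j * monomial (a j) 1) = 0 := by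
      rw [← coeff_sum, ← monomialPresentation_apply, LinearMap.mem_ker.1 hc, coeff_zero]
    obtain ⟨j, hji, hj⟩ : ∃ j, j ≠ i ∧ coeff (d + a i) (c j * monomial (a j) 1) ≠ 0 := by
      by_contra! H
      rw [Finset.sum_eq_single i (fun j _ h ↦ H j h) (by simp), coeff_mul_monomial, mul_one] at hsum
      exact hd hsum
    rw [coeff_mul_monomial'] at hj
    have hle : a j ≤ d + a i := by
      by_contra H
      simp [H] at hj
    rw [if_pos hle, mul_one] at hj
    have e₁ : d + a i - a i ⊔ a j + (a j - a i) = d := by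
      ext x
      have := hle x
      simp only [Finsupp.add_apply, Finsupp.tsub_apply, Finsupp.sup_apply] at this ⊢
      omega
    have e₂ : d + a i - a i ⊔ a j + (a i - a j) = d + a i - a j := by
      ext x
      have := hle x
      simp only [Finsupp.add_apply, Finsupp.tsub_apply, Finsupp.sup_apply] at this ⊢
      omega
    set w := monomial (d + a i - a i ⊔ a j) (coeff d (c i)) • monomialSyzygy K a (i, j) with hw
    have hwmem : w ∈ Submodule.span (MvPolynomial σ K) (Set.range (monomialSyzygy K a)) :=
      Submodule.smul_mem _ _ (Submodule.subset_span ⟨_, rfl⟩)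
    have hwker : w ∈ LinearMap.ker (monomialPresentation K a) :=
      Submodule.smul_mem _ _ (monomialSyzygy_mem_ker a _)
    have hwi : w i = monomial d (coeff d (c i)) := by
      rw [hw, Pi.smul_apply, monomialSyzygy_apply_fst a hji.symm, smul_eq_mul, monomial_mul, e₁,
        mul_one]
    have hwj : w j = -monomial (d + a i - a j) (coeff d (c i)) := by
      rw [hw, Pi.smul_apply, monomialSyzygy_apply_snd a hji.symm, smul_eq_mul, mul_neg,
        monomial_mul, e₂, mul_one]
    have hwk (k : ι) (h₁ : i ≠ k) (h₂ : j ≠ k) : w k = 0 := by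
      rw [hw, Pi.smul_apply, monomialSyzygy_apply_of_ne a h₁ h₂, smul_zero]
    have hsupp_i : ((c - w) i).support ⊂ (c i).support := by
      refine (Finset.ssubset_iff_of_subset fun m hm ↦ ?_).2 ⟨d, ?_, ?_⟩
      · rw [mem_support_iff, Pi.sub_apply, hwi, coeff_sub, coeff_monomial] at hm
        rw [mem_support_iff]
        rintro h
        split_ifs at hm with hdm
        · rw [hdm] at hm; simp at hm
        · simp [h] at hm
      · exact mem_support_iff.2 hd
      · simp [hwi]
    have hsupp (k : ι) : ((c - w) k).support ⊆ (c k).support := by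
      by_cases h₁ : i = k
      · exact h₁ ▸ hsupp_i.1
      by_cases h₂ : j = k
      · subst h₂
        intro m hm
        rw [mem_support_iff, Pi.sub_apply, hwj, coeff_sub, coeff_neg, coeff_monomial] at hm
        rw [mem_support_iff]
        split_ifs at hm with hdm
        · rwa [← hdm]
        · simpa using hm
      · rw [Pi.sub_apply, hwk k h₁ h₂, sub_zero]
    have := ih _ (Finset.sum_lt_sum (fun k _ ↦ Finset.card_le_card (hsupp k))
      ⟨i, Finset.mem_univ _, Finset.card_lt_card hsupp_i⟩) (c - w) (sub_mem hc hwker) rfl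
    simpa using add_mem this hwmem

end MonomialSyzygies

section LocalGenerators

/-- A finitely generated projective kernel of a monomial presentation is generated, locally at
the origin, by fewer Taylor relations than there are monomials. -/
theorem exists_card_lt_local_generators {σ ι K : Type*} [Field K] [Finite σ] [Fintype ι]
    [DecidableEq ι] [Nonempty ι] (a : ι → σ →₀ ℕ)
    [Module.Projective (MvPolynomial σ K) (LinearMap.ker (monomialPresentation K a))] :
    ∃ T : Finset (ι × ι), T.card < Fintype.card ι ∧ ∀ p, ∃ s : MvPolynomial σ K,
      coeff 0 s ≠ 0 ∧ s • monomialSyzygy K a p ∈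
        Submodule.span (MvPolynomial σ K) (monomialSyzygy K a '' T) := by
  classical
  let S := MvPolynomial σ K
  let N := LinearMap.ker (monomialPresentation K a)
  let m : Ideal S := RingHom.ker (constantCoeff (R := K) (σ := σ))
  have : m.IsPrime := RingHom.ker_isPrime _
  have hm (s : S) : s ∈ m.primeCompl ↔ coeff 0 s ≠ 0 := Iff.rfl
  let A := Localization.AtPrime m
  let φ := LocalizedModule.mkLinearMap m.primeCompl N
  let v : ι × ι → N := fun p ↦ ⟨monomialSyzygy K a p, monomialSyzygy_mem_ker a p⟩
  have hv : Submodule.span S (Set.range v) = ⊤ := by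
    apply Submodule.map_injective_of_injective N.injective_subtype
    rw [Submodule.map_span, ← Set.range_comp, Submodule.map_top, Submodule.range_subtype]
    exact (ker_monomialPresentation a).symm
  have hφv : Submodule.span A (Set.range (φ ∘ v)) = ⊤ := by
    rw [Set.range_comp]
    exact span_eq_top_of_isLocalizedModule A m.primeCompl φ hv
  have : Module.Projective A (LocalizedModule m.primeCompl N) :=
    inferInstanceAs (Module.Projective (Localization m.primeCompl) _)
  have : IsNoetherianRing A := IsLocalization.isNoetherianRing m.primeCompl A inferInstance
  have : Module.Finite A (LocalizedModule m.primeCompl N) :=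
    inferInstanceAs (Module.Finite (Localization m.primeCompl) _)
  have : Module.FinitePresentation A (LocalizedModule m.primeCompl N) :=
    Module.finitePresentation_of_finite A (LocalizedModule m.primeCompl N)
  obtain ⟨κ, α, b, hb⟩ := Module.exists_basis_of_span_of_flat (φ ∘ v) hφv
  have : Finite κ := Module.Finite.finite_basis b
  have := Fintype.ofFinite κ
  have hb' : (b : κ → _) = φ ∘ (v ∘ α) := funext hb
  refine ⟨Finset.univ.image α, ?_, fun p ↦ ?_⟩
  · refine Finset.card_image_le.trans_lt ?_
    have hinj : Function.Injective (algebraMap S A) :=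
      IsLocalization.injective A m.primeCompl_le_nonZeroDivisors
    have hli : LinearIndependent S (fun k ↦ monomialSyzygy K a (α k)) := by
      have h₁ : LinearIndependent S b := b.linearIndependent.restrict_scalars (by
        simpa [Algebra.smul_def] using hinj)
      rw [hb'] at h₁
      exact (LinearIndependent.of_comp φ h₁).map' N.subtype (Submodule.ker_subtype _)
    obtain ⟨i₀⟩ := ‹Nonempty ι›
    have hli' : LinearIndependent S (fun o : Option κ ↦
        o.elim (Pi.single i₀ (1 : S)) fun k ↦ monomialSyzygy K a (α k)) := by
      rw [Fintype.linearIndependent_iff] at hli ⊢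
      intro c hc
      rw [Fintype.sum_option] at hc
      have hnone : c none = 0 := by
        have := congrArg (monomialPresentation K a) hc
        have hi₀ : monomialPresentation K a (Pi.single i₀ 1) = monomial (a i₀) 1 := by
          simp [monomialPresentation, Fintype.linearCombination_apply_single]
        simpa [LinearMap.mem_ker.1 (monomialSyzygy_mem_ker a _), hi₀] using this
      have hsome := hli (fun k ↦ c (some k)) (by simpa [hnone] using hc)
      rintro (_ | k)
      exacts [hnone, hsome k]
    have := hli'.fintype_card_le_finrank
    rw [Module.finrank_fintype_fun_eq_card, Fintype.card_option] at this
    simpa using this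
  · let W := Submodule.span S (Set.range (v ∘ α))
    have hmem : φ (v p) ∈ W.localized' A m.primeCompl φ := by
      rw [Submodule.localized'_span, ← Set.range_comp, ← hb', b.span_eq]
      trivial
    obtain ⟨w, hw, s, hs⟩ := (Submodule.mem_localized' _ _ _ _ _).1 hmem
    rw [IsLocalizedModule.mk'_eq_iff, Submonoid.smul_def, ← map_smul,
      IsLocalizedModule.eq_iff_exists m.primeCompl] at hs
    obtain ⟨c, hc⟩ := hs
    refine ⟨c * s, (hm _).1 (mul_mem c.2 s.2), ?_⟩
    have h₂ : ((c : S) * (s : S)) • v p ∈ W := by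
      have : ((c : S) * (s : S)) • v p = (c : S) • w := by
        rw [mul_smul]; exact hc.symm
      rw [this]
      exact W.smul_mem _ hw
    have h₃ := Submodule.mem_map_of_mem (f := N.subtype) h₂
    rw [Submodule.map_span, ← Set.range_comp] at h₃
    rw [Finset.coe_image, Finset.coe_univ, Set.image_univ, ← Set.range_comp]
    exact h₃

end LocalGenerators

section Leaf

variable {σ ι K : Type*} [Field K] [DecidableEq ι]

/-- The Taylor relations among the monomials indexed by `V` are generated, locally at the origin,
by the relations indexed by `T`, of which there are fewer than elements of `V`. -/
structure IsSyzygyTree (K : Type*) [Field K] (a : ι → σ →₀ ℕ) (V : Finset ι)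
    (T : Finset (ι × ι)) : Prop where
  card_lt : T.card < V.card
  subset : T ⊆ V ×ˢ V
  exists_smul_mem : ∀ p ∈ V ×ˢ V, ∃ s : MvPolynomial σ K,
    coeff 0 s ≠ 0 ∧ s • monomialSyzygy K a p ∈
      Submodule.span (MvPolynomial σ K) (monomialSyzygy K a '' T)

theorem le_of_monomial_dvd_mul {a b : σ →₀ ℕ} {s : MvPolynomial σ K} (hs : coeff 0 s ≠ 0)
    (h : monomial a 1 ∣ s * monomial b 1) : a ≤ b := by
  obtain ⟨t, ht⟩ := h
  have := congrArg (coeff b) ht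
  rw [mul_comm (monomial a _), coeff_mul_monomial', coeff_mul_monomial'] at this
  by_contra hab
  simp [hab, hs] at this

theorem IsSyzygyTree.exists_leaf {a : ι → σ →₀ ℕ} {V : Finset ι} {T : Finset (ι × ι)}
    (h : IsSyzygyTree K a V T) (hV : V.Nontrivial) :
    ∃ i ∈ V, (∃ j ∈ V, j ≠ i ∧ ∀ k ∈ V, k ≠ i → a j - a i ≤ a k - a i) ∧
      ∃ T', IsSyzygyTree K a (V.erase i) T' := by
  obtain ⟨i, hiV, hi⟩ : ∃ i ∈ V, (T.filter fun e ↦ e.1 = i ∨ e.2 = i).card ≤ 1 := by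
    by_contra! H
    have h₁ : 2 * V.card ≤ ∑ i ∈ V, (T.filter fun e ↦ e.1 = i ∨ e.2 = i).card := by
      rw [mul_comm, ← smul_eq_mul]
      exact Finset.card_nsmul_le_sum _ _ _ H
    have h₂ : ∑ i ∈ V, (T.filter fun e ↦ e.1 = i ∨ e.2 = i).card ≤ 2 * T.card := by
      have := Finset.sum_card_bipartiteAbove_eq_sum_card_bipartiteBelow
        (s := V) (t := T) (fun i e ↦ e.1 = i ∨ e.2 = i)
      simp only [Finset.bipartiteAbove, Finset.bipartiteBelow] at this
      rw [this, mul_comm, ← smul_eq_mul]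
      refine Finset.sum_le_card_nsmul _ _ _ fun e _ ↦ ?_
      refine (Finset.card_le_card (t := {e.1, e.2}) fun x hx ↦ ?_).trans Finset.card_le_two
      have := (Finset.mem_filter.1 hx).2
      simp only [Finset.mem_insert, Finset.mem_singleton]
      tauto
    have := h.card_lt
    omega
  have hval (e : ι × ι) (he : monomialSyzygy K a e i ≠ 0) : ∃ j, j ≠ i ∧
      (e = (i, j) ∨ e = (j, i)) := by
    obtain ⟨k, l⟩ := e
    have hkl : k ≠ l := by
      rintro rfl
      simp [monomialSyzygy_self] at he
    by_cases hk : k = i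
    · exact ⟨l, hk ▸ hkl.symm, Or.inl (by rw [hk])⟩
    by_cases hl : l = i
    · exact ⟨k, hk, Or.inr (by rw [hl])⟩
    exact (he (monomialSyzygy_apply_of_ne a hk hl)).elim
  have hcoord (f : MvPolynomial σ K) (hf : ∀ e ∈ T, f ∣ monomialSyzygy K a e i) (k : ι)
      (hk : k ∈ V) (hki : k ≠ i) : ∃ s : MvPolynomial σ K, coeff 0 s ≠ 0 ∧
        f ∣ s * monomial (a k - a i) 1 := by
    obtain ⟨s, hs, hmem⟩ := h.exists_smul_mem (i, k) (by simp [hiV, hk])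
    refine ⟨s, hs, ?_⟩
    have hle : Submodule.span (MvPolynomial σ K) (monomialSyzygy K a '' T) ≤
        Submodule.comap (LinearMap.proj (R := MvPolynomial σ K)
          (φ := fun _ ↦ MvPolynomial σ K) i) (Ideal.span {f}) := by
      rw [Submodule.span_le]
      rintro _ ⟨e, he, rfl⟩
      exact Ideal.mem_span_singleton.2 (hf e he)
    have h0 : s * monomialSyzygy K a (i, k) i ∈ Ideal.span {f} := hle hmem
    rwa [monomialSyzygy_apply_fst a hki.symm, Ideal.mem_span_singleton] at h0
  obtain ⟨e, heT, he⟩ : ∃ e ∈ T, monomialSyzygy K a e i ≠ 0 := by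
    by_contra! H
    obtain ⟨k, hk, hki⟩ := hV.exists_ne i
    obtain ⟨s, hs, hdvd⟩ := hcoord 0 (fun e he ↦ (H e he) ▸ dvd_rfl) k hk hki
    have : s ≠ 0 := by
      rintro rfl
      simp at hs
    simp [this] at hdvd
  obtain ⟨j, hji, hej⟩ := hval e he
  have huniq (e' : ι × ι) (he' : e' ∈ T) (hne : e' ≠ e) : e'.1 ≠ i ∧ e'.2 ≠ i := by
    have hei : e.1 = i ∨ e.2 = i := by
      rcases hej with rfl | rfl <;> simp
    by_contra H
    exact hne (Finset.card_le_one.1 hi e' (Finset.mem_filter.2 ⟨he', by tauto⟩) e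
      (Finset.mem_filter.2 ⟨heT, hei⟩))
  have hjV : j ∈ V := by
    have := h.subset heT
    rcases hej with rfl | rfl <;> simp_all
  refine ⟨i, hiV, ⟨j, hjV, hji, fun k hk hki ↦ ?_⟩, T.erase e, ?_, ?_, ?_⟩
  · have hdvd (e' : ι × ι) (he' : e' ∈ T) : monomial (a j - a i) 1 ∣ monomialSyzygy K a e' i := by
      by_cases hee : e' = e
      · subst hee
        rcases hej with rfl | rfl
        · exact dvd_of_eq (monomialSyzygy_apply_fst a hji.symm).symm
        · exact (dvd_neg.2 dvd_rfl).trans (dvd_of_eq (monomialSyzygy_apply_snd a hji).symm)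
      · rw [monomialSyzygy_apply_of_ne a (huniq e' he' hee).1 (huniq e' he' hee).2]
        exact dvd_zero _
    obtain ⟨s, hs, hs'⟩ := hcoord _ hdvd k hk hki
    exact le_of_monomial_dvd_mul hs hs'
  · have := h.card_lt
    have := Finset.card_pos.2 ⟨e, heT⟩
    rw [Finset.card_erase_of_mem heT, Finset.card_erase_of_mem hiV]
    omega
  · intro e' he'
    rw [Finset.mem_erase] at he'
    have h₁ := Finset.mem_product.1 (h.subset he'.2)
    have h₂ := huniq e' he'.2 he'.1
    simp [h₁, h₂]
  · rintro ⟨k, l⟩ hp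
    simp only [Finset.mem_product, Finset.mem_erase] at hp
    obtain ⟨s, hs, hmem⟩ := h.exists_smul_mem (k, l) (by simp [hp])
    refine ⟨s, hs, ?_⟩
    rw [← Finset.insert_erase heT, Finset.coe_insert, Set.image_insert_eq,
      Submodule.mem_span_insert] at hmem
    obtain ⟨c, w, hw, hsum⟩ := hmem
    have hle : Submodule.span (MvPolynomial σ K) (monomialSyzygy K a '' (T.erase e)) ≤
        LinearMap.ker (LinearMap.proj (R := MvPolynomial σ K)
          (φ := fun _ ↦ MvPolynomial σ K) i) := by
      rw [Submodule.span_le]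
      rintro _ ⟨e', he', rfl⟩
      obtain ⟨hne, heT'⟩ := Finset.mem_erase.1 he'
      exact monomialSyzygy_apply_of_ne a (huniq e' heT' hne).1 (huniq e' heT' hne).2
    have hwi : w i = 0 := hle hw
    have hi0 := congrFun hsum i
    rw [Pi.smul_apply, monomialSyzygy_apply_of_ne a hp.1.1 hp.2.1, Pi.add_apply, hwi, smul_zero,
      add_zero, Pi.smul_apply, smul_eq_mul, zero_eq_mul] at hi0
    have hc : c = 0 := hi0.resolve_right he
    rwa [hsum, hc, zero_smul, zero_add]

end Leaf

section LeafOrder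

variable {n : ℕ}

/-- Each member of the list is a leaf of the complex generated by it and its predecessors. -/
def IsLeafOrder (L : List (Finset (Fin n))) : Prop :=
  ∀ i : Fin L.length, IsLeaf (gen {F | F ∈ L.take (i.1 + 1)}) (L.get i)

theorem isLeafOrder_concat {L : List (Finset (Fin n))} {F : Finset (Fin n)} :
    IsLeafOrder (L ++ [F]) ↔ IsLeafOrder L ∧ IsLeaf (gen {G | G ∈ L ++ [F]}) F := by
  constructor
  · refine fun h ↦ ⟨fun i ↦ ?_, ?_⟩
    · have := h ⟨i, i.2.trans (by simp)⟩
      simpa [List.take_append_of_le_length (Nat.succ_le_of_lt i.2)] using this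
    · simpa [List.take_of_length_le] using h ⟨L.length, by simp⟩
  · rintro ⟨h, hF⟩ ⟨i, hi⟩
    rcases Nat.lt_succ_iff_lt_or_eq.1 (by simpa using hi) with hi' | rfl
    · simpa [List.take_append_of_le_length (Nat.succ_le_of_lt hi'), List.getElem_append_left hi']
        using h ⟨i, hi'⟩
    · simpa [List.take_of_length_le] using hF

theorem isAntichain_facets (Δ : Set (Finset (Fin n))) : IsAntichain (· ⊆ ·) (facets Δ) :=
  fun _ hF G hG hne hle ↦ hne (hF.2 G hG.1 hle)

theorem facets_gen {S : Set (Finset (Fin n))} (hS : IsAntichain (· ⊆ ·) S) :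
    facets (gen S) = S := by
  ext F
  constructor
  · rintro ⟨⟨G, hG, hFG⟩, hmax⟩
    rwa [hmax G ⟨G, hG, subset_rfl⟩ hFG]
  · refine fun hF ↦ ⟨⟨F, hF, subset_rfl⟩, ?_⟩
    rintro G ⟨H, hH, hGH⟩ hFG
    obtain rfl := hS.eq hF hH (hFG.trans hGH)
    exact hFG.antisymm hGH

theorem facets_complements (Δ : Set (Finset (Fin n))) :
    facets (complements Δ) = (·ᶜ) '' facets Δ := by
  refine facets_gen ?_
  rintro _ ⟨F, hF, rfl⟩ _ ⟨G, hG, rfl⟩ hne hle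
  exact hne (congrArg _ (isAntichain_facets Δ |>.eq hG hF (compl_le_compl_iff_le.1 hle)).symm)

end LeafOrder

section SquarefreeMonomials

variable {n : ℕ} (K : Type) [Field K]

/-- The exponent vector of the squarefree monomial `x_A`. -/
noncomputable def sqfreeExp (A : Finset (Fin n)) : Fin n →₀ ℕ :=
  Finsupp.equivFunOnFinite.symm fun i ↦ if i ∈ A then 1 else 0

@[simp]
theorem sqfreeExp_apply (A : Finset (Fin n)) (i : Fin n) :
    sqfreeExp A i = if i ∈ A then 1 else 0 := rfl

theorem sqfreeExp_le_iff {A : Finset (Fin n)} {d : Fin n →₀ ℕ} :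
    sqfreeExp A ≤ d ↔ ∀ i ∈ A, 1 ≤ d i := by
  refine forall_congr' fun i ↦ ?_
  by_cases h : i ∈ A <;> simp [h]

theorem xF_eq_monomial (A : Finset (Fin n)) : xF K A = monomial (sqfreeExp A) 1 := by
  have : sqfreeExp A = ∑ i ∈ A, Finsupp.single i 1 := by
    ext j
    simp [Finsupp.finsetSum_apply, Finsupp.single_apply]
  rw [xF, this, monomial_sum_one]
  rfl

theorem mem_span_xF_iff {S : Set (Finset (Fin n))} {p : MvPolynomial (Fin n) K} :
    p ∈ Ideal.span (xF K '' S) ↔ ∀ d ∈ p.support, ∃ A ∈ S, sqfreeExp A ≤ d := by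
  have : xF K '' S = (fun d ↦ monomial d 1) '' (sqfreeExp '' S) := by
    rw [Set.image_image]
    simp only [xF_eq_monomial]
  rw [this, mem_ideal_span_monomial_image]
  simp

theorem xF_dvd_iff {A : Finset (Fin n)} {p : MvPolynomial (Fin n) K} :
    xF K A ∣ p ↔ ∀ d ∈ p.support, sqfreeExp A ≤ d := by
  rw [← Ideal.mem_span_singleton, ← Set.image_singleton, mem_span_xF_iff]
  simp

/-- The colon ideal of the complementary monomials of a family by that of `F` is principal if
`F` has a branch `G` in the family. -/
theorem smul_xF_compl_mem_span_iff {S : Set (Finset (Fin n))} {F G : Finset (Fin n)} (hG : G ∈ S)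
    (hbranch : ∀ H ∈ S, H ∩ F ⊆ G ∩ F) (c : MvPolynomial (Fin n) K) :
    c • xF K Fᶜ ∈ Ideal.span (xF K '' ((·ᶜ) '' S)) ↔ xF K (F \ G) ∣ c := by
  constructor
  · intro h
    rw [xF_dvd_iff]
    intro d hd
    have hd' : d + sqfreeExp Fᶜ ∈ (c • xF K Fᶜ).support := by
      rw [mem_support_iff, smul_eq_mul, xF_eq_monomial, coeff_mul_monomial, mul_one]
      exact mem_support_iff.1 hd
    obtain ⟨_, ⟨H, hH, rfl⟩, hle⟩ := (mem_span_xF_iff K).1 h _ hd'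
    rw [sqfreeExp_le_iff] at hle ⊢
    intro i hi
    obtain ⟨hiF, hiG⟩ := Finset.mem_sdiff.1 hi
    have hiH : i ∉ H := fun hiH ↦
      hiG (Finset.mem_inter.1 (hbranch H hH (Finset.mem_inter.2 ⟨hiH, hiF⟩))).1
    simpa [hiF] using hle i (by simpa using hiH)
  · rintro ⟨d, rfl⟩
    have : xF K Gᶜ ∣ (xF K (F \ G) * d) • xF K Fᶜ := by
      have : xF K (F \ G) * xF K Fᶜ = xF K (F \ G ∪ Fᶜ) := by
        refine (Finset.prod_union ?_).symm
        exact disjoint_compl_right.mono_left Finset.sdiff_subset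
      rw [smul_eq_mul, mul_right_comm, this]
      refine dvd_mul_of_dvd_left (Finset.prod_dvd_prod_of_subset _ _ _ fun i hi ↦ ?_) _
      simp only [Finset.mem_union, Finset.mem_sdiff, Finset.mem_compl] at hi ⊢
      tauto
    exact Ideal.mem_of_dvd _ this (Ideal.subset_span ⟨_, ⟨G, hG, rfl⟩, rfl⟩)

end SquarefreeMonomials

section Main

variable {n : ℕ} {K : Type} [Field K]

theorem exists_free_presentation (L : List (Finset (Fin n))) (hL : L.Nodup)
    (hanti : IsAntichain (· ⊆ ·) {F | F ∈ L}) (hleaf : IsLeafOrder L) :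
    ∃ (M : Type) (_ : AddCommGroup M) (_ : Module (MvPolynomial (Fin n) K) M)
      (_ : Module.Free (MvPolynomial (Fin n) K) M)
      (f : M →ₗ[MvPolynomial (Fin n) K] MvPolynomial (Fin n) K),
      LinearMap.range f = Ideal.span (xF K '' ((·ᶜ) '' {F | F ∈ L})) ∧
        Module.Projective (MvPolynomial (Fin n) K) (LinearMap.ker f) := by
  induction L using List.reverseRecOn with
  | nil =>
    refine ⟨PUnit, inferInstance, inferInstance, inferInstance, 0, ?_, ?_⟩
    · simp
    · exact .of_equiv (LinearEquiv.ofEq _ _ LinearMap.ker_zero |>.trans Submodule.topEquiv).symm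
  | append_singleton L F ih =>
    rw [isLeafOrder_concat] at hleaf
    obtain ⟨hleafL, hF⟩ := hleaf
    have hFL : F ∉ L := by
      simp only [List.nodup_append, List.mem_singleton] at hL
      exact fun h ↦ hL.2.2 F h F rfl rfl
    have hxF (A : Finset (Fin n)) : xF K A ≠ 0 := by
      rw [xF_eq_monomial]
      simp
    obtain ⟨M, _, _, _, f, hf, hproj⟩ := ih hL.of_append_left
      (hanti.subset fun G hG ↦ List.mem_append_left _ hG) hleafL
    have hrange : LinearMap.range (f.coprod (LinearMap.toSpanSingleton _ _ (xF K Fᶜ))) =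
        Ideal.span (xF K '' ((·ᶜ) '' {G | G ∈ L ++ [F]})) := by
      have : {G | G ∈ L ++ [F]} = {G | G ∈ L} ∪ {F} := by
        ext
        simp [or_comm]
      rw [LinearMap.range_coprod, hf, LinearMap.range_toSpanSingleton, this, Set.image_union,
        Set.image_union, Ideal.span_union, Set.image_singleton, Set.image_singleton]
    rcases hF.2 with hsingle | ⟨G, hG, hGF, hbranch⟩
    · rw [facets_gen hanti] at hsingle
      have hLnil : {G | G ∈ L} = ∅ := by
        rw [Set.eq_empty_iff_forall_notMem]
        intro G hG
        have : G ∈ ({F} : Set _) := hsingle ▸ List.mem_append_left _ hG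
        exact hFL (this ▸ hG)
      refine ⟨_, _, _, inferInstance, LinearMap.toSpanSingleton _ _ (xF K Fᶜ), ?_, ?_⟩
      · rw [← hrange, LinearMap.range_coprod, hf, hLnil]
        simp
      · rw [LinearMap.ker_toSpanSingleton _ (hxF _)]
        infer_instance
    · rw [facets_gen hanti] at hG hbranch
      have hGL : G ∈ L := by simpa [hGF] using hG
      refine ⟨_, _, _, inferInstance, _, hrange, ?_⟩
      refine projective_ker_coprod_toSpanSingleton _ (xF K (F \ G))
        (mem_nonZeroDivisors_of_ne_zero (hxF _)) fun c ↦ ?_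
      rw [hf]
      exact smul_xF_compl_mem_span_iff K (S := {G | G ∈ L}) hGL (fun H hH ↦
        hbranch H (List.mem_append_left _ hH) fun h ↦ hFL (h ▸ hH)) c

theorem IsSyzygyTree.exists_leafOrder {ι : Type*} [DecidableEq ι] {F : ι → Finset (Fin n)}
    (hF : Function.Injective F) (hanti : IsAntichain (· ⊆ ·) (Set.range F)) {V : Finset ι}
    {T : Finset (ι × ι)} (h : IsSyzygyTree K (fun i ↦ sqfreeExp (F i)ᶜ) V T) :
    ∃ L : List ι, L.Nodup ∧ L.toFinset = V ∧ IsLeafOrder (L.map F) := by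
  induction hN : V.card generalizing V T with
  | zero =>
    have := h.card_lt
    omega
  | succ N ih =>
    have hfacets (L : List ι) : facets (gen {G | G ∈ L.map F}) = {G | G ∈ L.map F} := by
      refine facets_gen (hanti.subset ?_)
      intro G hG
      obtain ⟨i, -, rfl⟩ := List.mem_map.1 hG
      exact ⟨i, rfl⟩
    rcases V.eq_empty_or_nonempty.resolve_left (by rintro rfl; simp at hN) |>.exists_eq_singleton_or_nontrivial
      with ⟨i, rfl⟩ | hV
    · refine ⟨[i], by simp, by simp, ?_⟩
      rw [List.map_singleton, ← List.nil_append [F i], isLeafOrder_concat]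
      refine ⟨fun j ↦ j.elim0, ?_⟩
      have := hfacets [i]
      rw [List.map_singleton] at this
      rw [List.nil_append, IsLeaf, this]
      simp
    · obtain ⟨i, hi, ⟨j, hj, hji, hle⟩, T', hT'⟩ := h.exists_leaf hV
      obtain ⟨L, hL, hLV, hleaf⟩ := ih hT' (by rw [Finset.card_erase_of_mem hi, hN]; rfl)
      have hmem (k : ι) : k ∈ L ↔ k ≠ i ∧ k ∈ V := by
        rw [← List.mem_toFinset, hLV, Finset.mem_erase]
      refine ⟨L ++ [i], ?_, ?_, ?_⟩
      · simpa [List.nodup_append, hL, hmem] using fun _ h _ ↦ h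
      · ext k
        by_cases hk : k = i <;> simp [hmem, hk, hi]
      · rw [List.map_append, List.map_singleton, isLeafOrder_concat]
        refine ⟨hleaf, ?_⟩
        have := hfacets (L ++ [i])
        rw [List.map_append, List.map_singleton] at this
        rw [IsLeaf, this]
        refine ⟨by simp, Or.inr ⟨F j, ?_, hF.ne hji, ?_⟩⟩
        · simpa using Or.inl ⟨j, (hmem j).2 ⟨hji, hj⟩, rfl⟩
        · intro H hH hHne x hx
          obtain ⟨k, hk, rfl⟩ : ∃ k ∈ L, F k = H := by simpa [hHne] using hH
          have hk' := (hmem k).1 hk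
          have hxle := hle k hk'.2 hk'.1 x
          obtain ⟨hxk, hxi⟩ := Finset.mem_inter.1 hx
          by_contra hxj
          simp [hxk, hxi] at hxle hxj
          simp [hxj] at hxle

end Main

/-- A simplicial complex `Δ` on `[n]`, all of whose facets are proper
subsets of `[n]`, is a quasi-tree if and only if the facet ideal `I(Δ^c)` has
projective dimension at most 1 as a module over `S = K[x₁,…,x_n]`. -/
theorem stmt_7 {n : ℕ} (K : Type) [Field K] (Δ : Set (Finset (Fin n)))
    (hΔ : IsComplex Δ) (hproper : ∀ F ∈ facets Δ, F ≠ Finset.univ) :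
    IsQuasiTree Δ ↔
      ProjDimLEOne (MvPolynomial (Fin n) K) (facetIdeal K (complements Δ)) := by
  classical
  constructor
  · rintro ⟨L, hL, hLΔ, hleaf⟩
    obtain ⟨M, _, _, _, f, hf, _⟩ := exists_free_presentation (K := K) L hL
      (hLΔ ▸ isAntichain_facets Δ) hleaf
    rw [facetIdeal, facets_complements, ← hLΔ, ← hf]
    exact ProjDimLEOne.of_free f
  · intro h
    have := Fintype.ofFinite (facets Δ)
    let a : facets Δ → Fin n →₀ ℕ := fun F ↦ sqfreeExp (F : Finset (Fin n))ᶜ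
    have hrange : facetIdeal K (complements Δ) = LinearMap.range (monomialPresentation K a) := by
      rw [range_monomialPresentation, facetIdeal, facets_complements, Set.image_image,
        Set.image_eq_range]
      simp only [xF_eq_monomial, a]
    rw [hrange] at h
    have := h.projective_ker _ (monomialPresentation K a).surjective_rangeRestrict
    rw [LinearMap.ker_rangeRestrict] at this
    obtain ⟨L, hL, hLV, hleaf⟩ : ∃ L : List (facets Δ), L.Nodup ∧ L.toFinset = Finset.univ ∧
        IsLeafOrder (L.map Subtype.val) := by
      rcases isEmpty_or_nonempty (facets Δ) with _ | _
      · exact ⟨[], by simp, by simp, fun i ↦ i.elim0⟩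
      · obtain ⟨T, hT, hgen⟩ := exists_card_lt_local_generators (K := K) a
        exact IsSyzygyTree.exists_leafOrder (K := K) Subtype.val_injective
          (Subtype.range_coe ▸ isAntichain_facets Δ) ⟨hT, by simp, fun p _ ↦ hgen p⟩
    refine ⟨L.map Subtype.val, hL.map Subtype.val_injective, ?_, hleaf⟩
    ext F
    have hmem (G : facets Δ) : G ∈ L := by
      rw [← List.mem_toFinset, hLV]
      exact Finset.mem_univ _
    simp [hmem]
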